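/- Let S^n carry the Euclidean metric. For any r ≤ √2, the isometric embeddings x ↦ δ_x of S^n into VR_2((S^n,ℓ_2);r) and into Čech_2((S^n,ℓ_2);r) are homotopy equivalences. For r > √2, the spaces VR_2((S^n,ℓ_2);r) and Čech_2((S^n,ℓ_2);r) are contractible. The same conclusions hold for the finitely supported versions VR_2^fin((S^n,ℓ_2);r) and Čech_2^fin((S^n,ℓ_2);r). -/

import Mathlib

open MeasureTheory ENNReal NNReal

noncomputable section

namespace Paper

variable {X Y : Type*}

/-- The (topological) support of a measure: points all of whose open neighborhoods
have positive measure. -/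
def msupport [TopologicalSpace X] [MeasurableSpace X] (α : Measure X) : Set X :=
  {x | ∀ U : Set X, IsOpen U → x ∈ U → 0 < α U}

/-- The `p`-diameter of a measure, `p ∈ [1,∞]`.  For `p = ∞` it is the diameter of the
support; for finite `p` it is `(∬ d(x,x')^p dα dα)^{1/p}`. -/
def pDiam [PseudoEMetricSpace X] [MeasurableSpace X] (p : ℝ≥0∞) (α : Measure X) : ℝ≥0∞ :=
  if p = ∞ then EMetric.diam (msupport α)
  else (∫⁻ x, ∫⁻ y, edist x y ^ p.toReal ∂α ∂α) ^ (1 / p.toReal)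

/-- The `p`-radius of a measure, `p ∈ [1,∞]`.  For `p = ∞` it is the radius of the
support; for finite `p` it is `inf_x (∫ d(x,x')^p dα)^{1/p}`. -/
def pRad [PseudoEMetricSpace X] [MeasurableSpace X] (p : ℝ≥0∞) (α : Measure X) : ℝ≥0∞ :=
  if p = ∞ then ⨅ x : X, ⨆ a ∈ msupport α, edist x a
  else ⨅ x : X, (∫⁻ y, edist x y ^ p.toReal ∂α) ^ (1 / p.toReal)

/-- Couplings between two measures: measures on the product with the given marginals. -/
def Coupling [MeasurableSpace X] (α β : Measure X) : Set (Measure (X × X)) :=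
  {μ | μ.map Prod.fst = α ∧ μ.map Prod.snd = β}

/-- The `q`-Wasserstein distance, `q ∈ [1,∞]`. -/
def wDist [PseudoEMetricSpace X] [MeasurableSpace X] (q : ℝ≥0∞) (α β : Measure X) : ℝ≥0∞ :=
  if q = ∞ then ⨅ μ ∈ Coupling α β, ⨆ z ∈ msupport μ, edist z.1 z.2
  else ⨅ μ ∈ Coupling α β, (∫⁻ z, edist z.1 z.2 ^ q.toReal ∂μ) ^ (1 / q.toReal)

/-- The distortion `sup |d(x,x') - d(f x, f x')|` of a map between (pseudo e)metric spaces. -/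
def distortion [PseudoEMetricSpace X] [PseudoEMetricSpace Y] (f : X → Y) : ℝ≥0∞ :=
  ⨆ x : X, ⨆ x' : X,
    max (edist x x' - edist (f x) (f x')) (edist (f x) (f x') - edist x x')

/-- The codistortion `sup_{x,y} |d_X(x, ψ y) - d_Y(φ x, y)|` of a pair of maps. -/
def codistortion [PseudoEMetricSpace X] [PseudoEMetricSpace Y] (φ : X → Y) (ψ : Y → X) :
    ℝ≥0∞ :=
  ⨆ x : X, ⨆ y : Y,
    max (edist x (ψ y) - edist (φ x) y) (edist (φ x) y - edist x (ψ y))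

/-- Gromov--Hausdorff distance, via the distortion/codistortion formula. -/
def ghDist (X Y : Type*) [PseudoEMetricSpace X] [PseudoEMetricSpace Y] : ℝ≥0∞ :=
  (1 / 2 : ℝ≥0∞) *
    ⨅ φ : X → Y, ⨅ ψ : Y → X,
      max (distortion φ) (max (distortion ψ) (codistortion φ ψ))

/-- The invariant `i_{q,p}(α) = (∫ d_{W,q}(α, δ_x)^p dα(x))^{1/p}`. -/
def iInv [PseudoEMetricSpace X] [MeasurableSpace X] (q p : ℝ≥0∞) (α : Measure X) : ℝ≥0∞ :=
  if p = ∞ then ⨆ x ∈ msupport α, wDist q α (Measure.dirac x)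
  else (∫⁻ x, wDist q α (Measure.dirac x) ^ p.toReal ∂α) ^ (1 / p.toReal)

/-- Dirac delta as a probability measure. -/
def diracPM [MeasurableSpace X] (x : X) : ProbabilityMeasure X :=
  ⟨Measure.dirac x, inferInstance⟩

/-- Finitely supported probability measures. -/
def finPM (X : Type*) [TopologicalSpace X] [MeasurableSpace X] : Set (ProbabilityMeasure X) :=
  {α | (msupport α.toMeasure).Finite}

/-- The `p`-Vietoris--Rips metric thickening at scale `r`, as a subset of the space of
probability measures with the weak topology. -/
def VRm (p : ℝ≥0∞) (X : Type*) [PseudoEMetricSpace X] [MeasurableSpace X] (r : ℝ≥0∞) :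
    Set (ProbabilityMeasure X) :=
  {α | pDiam p α.toMeasure < r}

/-- The `p`-Čech metric thickening at scale `r`. -/
def Cechm (p : ℝ≥0∞) (X : Type*) [PseudoEMetricSpace X] [MeasurableSpace X] (r : ℝ≥0∞) :
    Set (ProbabilityMeasure X) :=
  {α | pRad p α.toMeasure < r}

/-- Finitely supported version of the `p`-Vietoris--Rips thickening. -/
def VRmFin (p : ℝ≥0∞) (X : Type*) [PseudoEMetricSpace X] [MeasurableSpace X] (r : ℝ≥0∞) :
    Set (ProbabilityMeasure X) :=
  VRm p X r ∩ finPM X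

/-- Finitely supported version of the `p`-Čech thickening. -/
def CechmFin (p : ℝ≥0∞) (X : Type*) [PseudoEMetricSpace X] [MeasurableSpace X] (r : ℝ≥0∞) :
    Set (ProbabilityMeasure X) :=
  Cechm p X r ∩ finPM X


/-- Convex combination `(1-t)·α + t·β` of probability measures. -/
def lincomb [MeasurableSpace X] (t : ℝ) (h0 : 0 ≤ t) (h1 : t ≤ 1)
    (α β : ProbabilityMeasure X) : ProbabilityMeasure X :=
  ⟨ENNReal.ofReal (1 - t) • α.toMeasure + ENNReal.ofReal t • β.toMeasure, by
    constructor
    simp only [Measure.coe_add, Pi.add_apply, Measure.smul_apply, smul_eq_mul,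
      measure_univ, mul_one]
    rw [← ENNReal.ofReal_add (by linarith) h0]
    norm_num⟩

/-- A `δ`-map between spaces-with-functions. -/
def IsDeltaMap {A B : Type*} [TopologicalSpace A] [TopologicalSpace B]
    (φA : A → ℝ) (φB : B → ℝ) (δ : ℝ) (F : A → B) : Prop :=
  Continuous F ∧ ∀ a, φB (F a) ≤ φA a + δ

/-- `δ`-homotopy between two `δ`-maps. -/
def DeltaHomotopic {A B : Type*} [TopologicalSpace A] [TopologicalSpace B]
    (φA : A → ℝ) (φB : B → ℝ) (δ : ℝ) (F₀ F₁ : A → B) : Prop :=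
  ∃ H : A × unitInterval → B, Continuous H ∧
    (∀ a, H (a, 0) = F₀ a) ∧ (∀ a, H (a, 1) = F₁ a) ∧
    ∀ t : unitInterval, IsDeltaMap φA φB δ (fun a => H (a, t))

/-- `δ`-homotopy equivalence between two spaces-with-functions. -/
def DeltaHomotopyEquiv {A B : Type*} [TopologicalSpace A] [TopologicalSpace B]
    (δ : ℝ) (φA : A → ℝ) (φB : B → ℝ) : Prop :=
  ∃ F : A → B, ∃ G : B → A,
    IsDeltaMap φA φB δ F ∧ IsDeltaMap φB φA δ G ∧
    DeltaHomotopic φA φA (2 * δ) (G ∘ F) id ∧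
    DeltaHomotopic φB φB (2 * δ) (F ∘ G) id

/-- The homotopy type distance `d_HT`. -/
def dHT {A B : Type*} [TopologicalSpace A] [TopologicalSpace B]
    (φA : A → ℝ) (φB : B → ℝ) : ℝ≥0∞ :=
  sInf {e : ℝ≥0∞ | ∃ δ : ℝ, 0 ≤ δ ∧ DeltaHomotopyEquiv δ φA φB ∧ e = ENNReal.ofReal δ}

/-- The `p`-spread of a metric space. -/
def pSpread (p : ℝ≥0∞) (X : Type*) [PseudoEMetricSpace X] [MeasurableSpace X] : ℝ≥0∞ :=
  ⨅ αs ∈ finPM X, ⨆ α : ProbabilityMeasure X,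
    wDist p (αs : ProbabilityMeasure X).toMeasure α.toMeasure

/-- The medial axis of a subset `X` of a normed space. -/
def medialAxis {E : Type*} [NormedAddCommGroup E] (X : Set E) : Set E :=
  closure {y | ∃ x₁ ∈ X, ∃ x₂ ∈ X, x₁ ≠ x₂ ∧
    dist y x₁ = Metric.infDist y X ∧ dist y x₂ = Metric.infDist y X}

/-- The reach of a subset `X`: the distance from `X` to its medial axis. -/
def reach {E : Type*} [NormedAddCommGroup E] (X : Set E) : ℝ≥0∞ :=
  ⨅ x ∈ X, ⨅ y ∈ medialAxis X, edist x y

/-- `p`-radius with the infimum restricted to a subset `X` of the ambient space. -/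
def pRadIn {E : Type*} [PseudoEMetricSpace E] [MeasurableSpace E] (p : ℝ≥0∞)
    (X : Set E) (α : Measure E) : ℝ≥0∞ :=
  ⨅ x ∈ X, (∫⁻ y, edist x y ^ p.toReal ∂α) ^ (1 / p.toReal)


lemma continuous_diracPM [TopologicalSpace X] [MeasurableSpace X] [OpensMeasurableSpace X] :
    Continuous (diracPM : X → ProbabilityMeasure X) :=
  continuous_diracProba

lemma integral_lincomb [MeasurableSpace X] {t : ℝ} (h0 : 0 ≤ t) (h1 : t ≤ 1)
    (α β : ProbabilityMeasure X) {f : X → ℝ} (hα : Integrable f α.toMeasure)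
    (hβ : Integrable f β.toMeasure) :
    ∫ x, f x ∂(lincomb t h0 h1 α β).toMeasure =
      (1 - t) * ∫ x, f x ∂α.toMeasure + t * ∫ x, f x ∂β.toMeasure := by
  change ∫ x, f x ∂(ENNReal.ofReal (1 - t) • α.toMeasure + ENNReal.ofReal t • β.toMeasure) = _
  rw [integral_add_measure (hα.smul_measure ofReal_ne_top) (hβ.smul_measure ofReal_ne_top),
    integral_smul_measure, integral_smul_measure, ENNReal.toReal_ofReal (by linarith),
    ENNReal.toReal_ofReal h0, smul_eq_mul, smul_eq_mul]

lemma continuous_lincomb {Z : Type*} [TopologicalSpace Z] [TopologicalSpace X]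
    [MeasurableSpace X] [OpensMeasurableSpace X] {f g : Z → ProbabilityMeasure X}
    (hf : Continuous f) (hg : Continuous g) :
    Continuous fun p : unitInterval × Z =>
      lincomb (p.1 : ℝ) p.1.2.1 p.1.2.2 (f p.2) (g p.2) := by
  rw [ProbabilityMeasure.continuous_iff_forall_continuous_integral]
  intro u
  simp_rw [fun p : unitInterval × Z => integral_lincomb p.1.2.1 p.1.2.2 (f p.2) (g p.2)
    (u.integrable (f p.2).toMeasure) (u.integrable (g p.2).toMeasure)]
  have hcf := ProbabilityMeasure.continuous_iff_forall_continuous_integral.1 hf u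
  have hcg := ProbabilityMeasure.continuous_iff_forall_continuous_integral.1 hg u
  have ht : Continuous fun p : unitInterval × Z => (p.1 : ℝ) := by fun_prop
  exact ((continuous_const.sub ht).mul (hcf.comp continuous_snd)).add
    (ht.mul (hcg.comp continuous_snd))

lemma lincomb_zero [MeasurableSpace X] (h0 : (0 : ℝ) ≤ 0) (h1 : (0 : ℝ) ≤ 1)
    (α β : ProbabilityMeasure X) : lincomb 0 h0 h1 α β = α := by
  apply Subtype.ext
  simp [lincomb]

lemma lincomb_one [MeasurableSpace X] (h0 : (0 : ℝ) ≤ 1) (h1 : (1 : ℝ) ≤ 1)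
    (α β : ProbabilityMeasure X) : lincomb 1 h0 h1 α β = β := by
  apply Subtype.ext
  simp [lincomb]

lemma diracPM_mem_finPM [TopologicalSpace X] [T1Space X] [MeasurableSpace X]
    [OpensMeasurableSpace X] (x : X) : diracPM x ∈ finPM X := by
  refine (Set.finite_singleton x).subset fun y hy => ?_
  by_contra hne
  have h := hy {x}ᶜ isOpen_compl_singleton hne
  simp [diracPM] at h

lemma lincomb_mem_finPM [TopologicalSpace X] [MeasurableSpace X] {t : ℝ} (h0 : 0 ≤ t)
    (h1 : t ≤ 1) {α β : ProbabilityMeasure X} (hα : α ∈ finPM X) (hβ : β ∈ finPM X) :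
    lincomb t h0 h1 α β ∈ finPM X := by
  refine (Set.Finite.union hα hβ).subset fun y hy => ?_
  by_contra hne
  simp only [Set.mem_union, not_or, msupport, Set.mem_ofPred_eq, not_forall, not_lt,
    nonpos_iff_eq_zero] at hne
  obtain ⟨⟨U, hU, hyU, hU0⟩, V, hV, hyV, hV0⟩ := hne
  have h := hy (U ∩ V) (hU.inter hV) ⟨hyU, hyV⟩
  have hU' : α.toMeasure (U ∩ V) = 0 := measure_mono_null Set.inter_subset_left hU0
  have hV' : β.toMeasure (U ∩ V) = 0 := measure_mono_null Set.inter_subset_right hV0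
  simp [lincomb, hU', hV'] at h

/-- A convex set of probability measures is contractible once it contains a point. -/
lemma contractibleSpace_of_lincomb_mem [TopologicalSpace X] [MeasurableSpace X]
    [OpensMeasurableSpace X] {W : Set (ProbabilityMeasure X)} {β : ProbabilityMeasure X}
    (hβ : β ∈ W) (hW : ∀ (t : ℝ) (h0 : 0 ≤ t) (h1 : t ≤ 1), ∀ α ∈ W, lincomb t h0 h1 α β ∈ W) :
    ContractibleSpace W := by
  rw [contractible_iff_id_nullhomotopic]
  refine ⟨⟨β, hβ⟩, ⟨⟨⟨fun p => ⟨lincomb (p.1 : ℝ) p.1.2.1 p.1.2.2 p.2.1 β,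
    hW _ _ _ _ p.2.2⟩, ?_⟩, fun α => ?_, fun α => ?_⟩⟩⟩
  · exact (continuous_lincomb continuous_subtype_val continuous_const).subtype_mk _
  · exact Subtype.ext (lincomb_zero le_rfl zero_le_one _ _)
  · exact Subtype.ext (lincomb_one zero_le_one le_rfl _ _)

section Sphere

variable {n : ℕ}

local notation "𝔼" n => EuclideanSpace ℝ (Fin (n + 1))
local notation "𝕊" n => Metric.sphere (0 : EuclideanSpace ℝ (Fin (n + 1))) 1

/-- The barycenter in the ambient Euclidean space of a probability measure on the sphere. -/
def mean (α : ProbabilityMeasure (𝕊 n)) : 𝔼 n :=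
  WithLp.toLp 2 fun i => ∫ y, y.1 i ∂α.toMeasure

lemma integrable_of_continuous {f : (𝕊 n) → ℝ} (hf : Continuous f)
    (α : ProbabilityMeasure (𝕊 n)) : Integrable f α.toMeasure :=
  (BoundedContinuousFunction.mkOfCompact ⟨f, hf⟩).integrable _

lemma continuous_mean : Continuous (mean : ProbabilityMeasure (𝕊 n) → 𝔼 n) := by
  refine (PiLp.continuous_toLp 2 _).comp (continuous_pi fun i => ?_)
  have h : Continuous fun y : 𝕊 n => y.1 i := by fun_prop
  exact ProbabilityMeasure.continuous_integral_boundedContinuousFunction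
    (BoundedContinuousFunction.mkOfCompact ⟨_, h⟩)

lemma integral_inner (α : ProbabilityMeasure (𝕊 n)) (x : 𝔼 n) :
    ∫ y, inner ℝ x y.1 ∂α.toMeasure = inner ℝ x (mean α) := by
  simp only [PiLp.inner_apply, mean]
  rw [integral_finsetSum _ fun i _ => integrable_of_continuous (by fun_prop) α]
  refine Finset.sum_congr rfl fun i _ => ?_
  simp only [RCLike.inner_apply, conj_trivial]
  rw [integral_mul_const]

lemma mean_diracPM (x : 𝕊 n) : mean (diracPM x) = x.1 := by
  ext i
  simp [mean, diracPM]

lemma mean_lincomb {t : ℝ} (h0 : 0 ≤ t) (h1 : t ≤ 1) (α β : ProbabilityMeasure (𝕊 n)) :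
    mean (lincomb t h0 h1 α β) = (1 - t) • mean α + t • mean β := by
  ext i
  simp only [mean, PiLp.add_apply, PiLp.smul_apply, smul_eq_mul]
  exact integral_lincomb h0 h1 α β (integrable_of_continuous (by fun_prop) α)
    (integrable_of_continuous (by fun_prop) β)

lemma edist_rpow_two (x y : 𝕊 n) :
    edist x y ^ (2 : ℝ≥0∞).toReal = ENNReal.ofReal (2 - 2 * inner ℝ x.1 y.1) := by
  have hx : ‖x.1‖ = 1 := norm_eq_of_mem_sphere x
  have hy : ‖y.1‖ = 1 := norm_eq_of_mem_sphere y
  have h := norm_sub_sq_real x.1 y.1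
  rw [hx, hy] at h
  rw [edist_dist, Subtype.dist_eq, dist_eq_norm, ENNReal.ofReal_rpow_of_nonneg (norm_nonneg _)
    (by simp)]
  congr 1
  norm_num
  linarith

lemma inner_sphere_le (x : 𝕊 n) (v : 𝔼 n) : inner ℝ x.1 v ≤ ‖v‖ := by
  have hx : ‖x.1‖ = 1 := norm_eq_of_mem_sphere x
  simpa [hx] using real_inner_le_norm x.1 v

lemma norm_mean_le_one (α : ProbabilityMeasure (𝕊 n)) : ‖mean α‖ ≤ 1 := by
  have h : ∫ y, inner ℝ (mean α) y.1 ∂α.toMeasure ≤ ∫ _, ‖mean α‖ ∂α.toMeasure := by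
    refine integral_mono (integrable_of_continuous (by fun_prop) α) (integrable_const _) ?_
    intro y
    simpa only [real_inner_comm] using inner_sphere_le y (mean α)
  rw [integral_inner, real_inner_self_eq_norm_sq] at h
  simp only [integral_const, probReal_univ, one_smul] at h
  nlinarith [norm_nonneg (mean α)]

lemma lintegral_edist_rpow_two (α : ProbabilityMeasure (𝕊 n)) (x : 𝕊 n) :
    ∫⁻ y, edist x y ^ (2 : ℝ≥0∞).toReal ∂α.toMeasure =
      ENNReal.ofReal (2 - 2 * inner ℝ x.1 (mean α)) := by
  simp_rw [edist_rpow_two]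
  rw [← ofReal_integral_eq_lintegral_ofReal
    (integrable_of_continuous (by fun_prop) α)]
  · congr 1
    rw [integral_sub (integrable_const _) (integrable_of_continuous (by fun_prop) α),
      integral_const_mul, integral_inner]
    simp
  · refine Filter.Eventually.of_forall fun y => ?_
    have hy : ‖y.1‖ = 1 := norm_eq_of_mem_sphere y
    have h := inner_sphere_le x y.1
    simp only [Pi.zero_apply]
    linarith

lemma lintegral_lintegral_edist_rpow_two (α : ProbabilityMeasure (𝕊 n)) :
    ∫⁻ x, ∫⁻ y, edist x y ^ (2 : ℝ≥0∞).toReal ∂α.toMeasure ∂α.toMeasure =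
      ENNReal.ofReal (2 - 2 * ‖mean α‖ ^ 2) := by
  simp_rw [lintegral_edist_rpow_two]
  rw [← ofReal_integral_eq_lintegral_ofReal
    (integrable_of_continuous (by fun_prop) α)]
  · congr 1
    rw [integral_sub (integrable_const _) (integrable_of_continuous (by fun_prop) α),
      integral_const_mul]
    simp_rw [real_inner_comm (mean α)]
    rw [integral_inner, real_inner_self_eq_norm_sq]
    simp
  · refine Filter.Eventually.of_forall fun y => ?_
    have h := inner_sphere_le y (mean α)
    have h' := norm_mean_le_one α
    simp only [Pi.zero_apply]
    linarith

lemma ofReal_rpow_half_lt_iff {a r : ℝ} (hr : 0 < r) :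
    ENNReal.ofReal a ^ (1 / (2 : ℝ≥0∞).toReal) < ENNReal.ofReal r ↔ a < r ^ 2 := by
  have h2 : (0 : ℝ) < (2 : ℝ≥0∞).toReal := by simp
  rw [one_div, ENNReal.rpow_inv_lt_iff h2, ENNReal.ofReal_rpow_of_pos hr,
    ENNReal.ofReal_lt_ofReal_iff (by positivity)]
  simp

lemma mem_VRm_iff {r : ℝ} (hr : 0 < r) (α : ProbabilityMeasure (𝕊 n)) :
    α ∈ VRm 2 (𝕊 n) (ENNReal.ofReal r) ↔ 1 - r ^ 2 / 2 < ‖mean α‖ ^ 2 := by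
  rw [VRm, Set.mem_ofPred_eq, pDiam, if_neg (by simp), lintegral_lintegral_edist_rpow_two,
    ofReal_rpow_half_lt_iff hr]
  constructor <;> intro h <;> linarith

lemma exists_inner_eq_norm (v : 𝔼 n) : ∃ x : 𝕊 n, inner ℝ x.1 v = ‖v‖ := by
  rcases eq_or_ne v 0 with rfl | hv
  · exact ⟨⟨EuclideanSpace.single 0 1, by simp⟩, by simp⟩
  · have hv' : ‖v‖ ≠ 0 := norm_ne_zero_iff.2 hv
    refine ⟨⟨‖v‖⁻¹ • v, by simp [norm_smul, hv']⟩, ?_⟩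
    simp only [real_inner_smul_left, real_inner_self_eq_norm_sq]
    field_simp

lemma mem_Cechm_iff {r : ℝ} (hr : 0 < r) (α : ProbabilityMeasure (𝕊 n)) :
    α ∈ Cechm 2 (𝕊 n) (ENNReal.ofReal r) ↔ 1 - r ^ 2 / 2 < ‖mean α‖ := by
  rw [Cechm, Set.mem_ofPred_eq, pRad, if_neg (by simp), iInf_lt_iff]
  simp_rw [lintegral_edist_rpow_two, ofReal_rpow_half_lt_iff hr]
  constructor
  · rintro ⟨x, hx⟩
    linarith [inner_sphere_le x (mean α)]
  · intro h
    obtain ⟨x, hx⟩ := exists_inner_eq_norm (mean α)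
    exact ⟨x, by linarith⟩

/-- Measures whose barycenter lies outside a closed ball of radius `c ∈ [0, 1)` about the origin
retract onto the sphere by radially projecting the barycenter. -/
lemma exists_homotopyEquiv_of_mem_iff {c : ℝ} (hc0 : 0 ≤ c) (hc1 : c < 1)
    {K W : Set (ProbabilityMeasure (𝕊 n))} (hdirac : ∀ x, diracPM x ∈ K)
    (hK : ∀ (t : ℝ) (h0 : 0 ≤ t) (h1 : t ≤ 1), ∀ α ∈ K, ∀ β ∈ K, lincomb t h0 h1 α β ∈ K)
    (hW : ∀ α, α ∈ W ↔ c < ‖mean α‖ ∧ α ∈ K) :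
    ∃ h : ContinuousMap.HomotopyEquiv (𝕊 n) W, ∀ x, (h.toFun x).1 = diracPM x := by
  have hpos : ∀ α : W, 0 < ‖mean α.1‖ := fun α => hc0.trans_lt ((hW _).1 α.2).1
  have hdW : ∀ x : 𝕊 n, diracPM x ∈ W := fun x => (hW _).2
    ⟨by rw [mean_diracPM, norm_eq_of_mem_sphere]; exact hc1, hdirac x⟩
  let ι : C(𝕊 n, W) := ⟨fun x => ⟨diracPM x, hdW x⟩, continuous_diracPM.subtype_mk _⟩
  have hcm : Continuous fun α : W => mean α.1 := continuous_mean.comp continuous_subtype_val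
  have hsphere : ∀ α : W, ‖mean α.1‖⁻¹ • mean α.1 ∈ 𝕊 n := fun α => by
    simp [norm_smul, (hpos α).ne']
  let π : C(W, 𝕊 n) := ⟨fun α => ⟨‖mean α.1‖⁻¹ • mean α.1, hsphere α⟩,
    ((hcm.norm.inv₀ fun α => (hpos α).ne').smul hcm).subtype_mk hsphere⟩
  have hmem : ∀ (t : unitInterval) (α : W),
      lincomb (t : ℝ) t.2.1 t.2.2 α.1 (diracPM (π α)) ∈ W := by
    intro t α
    obtain ⟨hcα, hαK⟩ := (hW _).1 α.2
    refine (hW _).2 ⟨?_, hK _ _ _ _ hαK _ (hdirac _)⟩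
    have ht0 : (0 : ℝ) ≤ t := t.2.1
    have ht1 : (t : ℝ) ≤ 1 := t.2.2
    have hinv : 1 ≤ ‖mean α.1‖⁻¹ := (one_le_inv₀ (hpos α)).2 (norm_mean_le_one _)
    have hmean : mean (lincomb (t : ℝ) t.2.1 t.2.2 α.1 (diracPM (π α))) =
        ((1 - t) + t * ‖mean α.1‖⁻¹) • mean α.1 := by
      rw [mean_lincomb, mean_diracPM]
      simp only [π, ContinuousMap.coe_mk, smul_smul, add_smul]
    have hcoef : 1 ≤ (1 - t) + t * ‖mean α.1‖⁻¹ := by nlinarith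
    rw [hmean, norm_smul, Real.norm_of_nonneg (by linarith)]
    nlinarith [hpos α]
  refine ⟨⟨ι, π, ?_, ContinuousMap.Homotopic.symm ⟨⟨⟨fun p =>
    ⟨lincomb (p.1 : ℝ) p.1.2.1 p.1.2.2 p.2.1 (diracPM (π p.2)), hmem p.1 p.2⟩, ?_⟩,
    fun α => ?_, fun α => ?_⟩⟩⟩, fun x => rfl⟩
  · convert ContinuousMap.Homotopic.refl _
    ext1 x
    apply Subtype.ext
    simp [π, ι, mean_diracPM]
  · exact (continuous_lincomb continuous_subtype_val
      (continuous_diracPM.comp π.continuous)).subtype_mk _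
  · exact Subtype.ext (lincomb_zero le_rfl zero_le_one _ _)
  · exact Subtype.ext (lincomb_one zero_le_one le_rfl _ _)

end Sphere

/-- For the unit sphere `S^n ⊆ ℝ^{n+1}` with the Euclidean metric:
for `0 < r ≤ √2` the embeddings `x ↦ δ_x` of `S^n` into `VR_2(S^n;r)` and `Čech_2(S^n;r)`
(and into their finitely supported versions) are homotopy equivalences, while for `r > √2`
all four spaces are contractible. -/
theorem sphere_two_thickening_homotopy_types {n : ℕ} :
    (∀ r : ℝ, 0 < r → r ≤ Real.sqrt 2 →
      (∃ h : ContinuousMap.HomotopyEquiv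
          ↥(Metric.sphere (0 : EuclideanSpace ℝ (Fin (n + 1))) 1)
          ↥(VRm 2 ↥(Metric.sphere (0 : EuclideanSpace ℝ (Fin (n + 1))) 1)
              (ENNReal.ofReal r)),
        ∀ x, (h.toFun x).1 = diracPM x) ∧
      (∃ h : ContinuousMap.HomotopyEquiv
          ↥(Metric.sphere (0 : EuclideanSpace ℝ (Fin (n + 1))) 1)
          ↥(Cechm 2 ↥(Metric.sphere (0 : EuclideanSpace ℝ (Fin (n + 1))) 1)
              (ENNReal.ofReal r)),
        ∀ x, (h.toFun x).1 = diracPM x) ∧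
      (∃ h : ContinuousMap.HomotopyEquiv
          ↥(Metric.sphere (0 : EuclideanSpace ℝ (Fin (n + 1))) 1)
          ↥(VRmFin 2 ↥(Metric.sphere (0 : EuclideanSpace ℝ (Fin (n + 1))) 1)
              (ENNReal.ofReal r)),
        ∀ x, (h.toFun x).1 = diracPM x) ∧
      (∃ h : ContinuousMap.HomotopyEquiv
          ↥(Metric.sphere (0 : EuclideanSpace ℝ (Fin (n + 1))) 1)
          ↥(CechmFin 2 ↥(Metric.sphere (0 : EuclideanSpace ℝ (Fin (n + 1))) 1)
              (ENNReal.ofReal r)),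
        ∀ x, (h.toFun x).1 = diracPM x)) ∧
    (∀ r : ℝ, Real.sqrt 2 < r →
      ContractibleSpace
        ↥(VRm 2 ↥(Metric.sphere (0 : EuclideanSpace ℝ (Fin (n + 1))) 1)
            (ENNReal.ofReal r)) ∧
      ContractibleSpace
        ↥(Cechm 2 ↥(Metric.sphere (0 : EuclideanSpace ℝ (Fin (n + 1))) 1)
            (ENNReal.ofReal r)) ∧
      ContractibleSpace
        ↥(VRmFin 2 ↥(Metric.sphere (0 : EuclideanSpace ℝ (Fin (n + 1))) 1)
            (ENNReal.ofReal r)) ∧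
      ContractibleSpace
        ↥(CechmFin 2 ↥(Metric.sphere (0 : EuclideanSpace ℝ (Fin (n + 1))) 1)
            (ENNReal.ofReal r))) := by
  have hS : Nonempty (Metric.sphere (0 : EuclideanSpace ℝ (Fin (n + 1))) 1) :=
    (exists_inner_eq_norm (0 : EuclideanSpace ℝ (Fin (n + 1)))).nonempty
  have hfin := fun (t : ℝ) (h0 : 0 ≤ t) (h1 : t ≤ 1)
    (α : ProbabilityMeasure (Metric.sphere (0 : EuclideanSpace ℝ (Fin (n + 1))) 1))
    (hα : α ∈ finPM _) β hβ => lincomb_mem_finPM (β := β) h0 h1 hα hβ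
  refine ⟨fun r hr0 hr => ?_, fun r hr => ?_⟩
  · have hr2 : r ^ 2 ≤ 2 := (Real.le_sqrt hr0.le (by norm_num)).1 hr
    have hr2' : 0 < r ^ 2 := by positivity
    have hc0 : 0 ≤ 1 - r ^ 2 / 2 := by linarith
    have hc1 : 1 - r ^ 2 / 2 < 1 := by linarith
    have hs1 : √(1 - r ^ 2 / 2) < 1 := by
      rw [Real.sqrt_lt' one_pos]
      linarith
    refine ⟨exists_homotopyEquiv_of_mem_iff (K := Set.univ) (Real.sqrt_nonneg _) hs1 (by simp)
        (by simp) fun α => ?_,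
      exists_homotopyEquiv_of_mem_iff (K := Set.univ) hc0 hc1 (by simp) (by simp) fun α => ?_,
      exists_homotopyEquiv_of_mem_iff (K := finPM _) (Real.sqrt_nonneg _) hs1 diracPM_mem_finPM
        hfin fun α => ?_,
      exists_homotopyEquiv_of_mem_iff (K := finPM _) hc0 hc1 diracPM_mem_finPM hfin
        fun α => ?_⟩
    · rw [mem_VRm_iff hr0, Real.sqrt_lt hc0 (norm_nonneg _)]
      simp
    · rw [mem_Cechm_iff hr0]
      simp
    · rw [VRmFin, Set.mem_inter_iff, mem_VRm_iff hr0, Real.sqrt_lt hc0 (norm_nonneg _)]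
    · rw [CechmFin, Set.mem_inter_iff, mem_Cechm_iff hr0]
  · have hr0 : 0 < r := (Real.sqrt_nonneg 2).trans_lt hr
    have hr2 : 2 < r ^ 2 := (Real.sqrt_lt' hr0).1 hr
    have hV : ∀ α, α ∈ VRm 2 (Metric.sphere (0 : EuclideanSpace ℝ (Fin (n + 1))) 1)
        (ENNReal.ofReal r) := fun α =>
      (mem_VRm_iff hr0 α).2 (by nlinarith [sq_nonneg ‖mean α‖])
    have hC : ∀ α, α ∈ Cechm 2 (Metric.sphere (0 : EuclideanSpace ℝ (Fin (n + 1))) 1)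
        (ENNReal.ofReal r) := fun α =>
      (mem_Cechm_iff hr0 α).2 (by linarith [norm_nonneg (mean α)])
    obtain ⟨x⟩ := hS
    have hx := diracPM_mem_finPM x
    exact ⟨contractibleSpace_of_lincomb_mem (hV (diracPM x)) fun _ _ _ _ _ => hV _,
      contractibleSpace_of_lincomb_mem (hC (diracPM x)) fun _ _ _ _ _ => hC _,
      contractibleSpace_of_lincomb_mem (W := VRmFin _ _ _) ⟨hV _, hx⟩
        fun t h0 h1 α hα => ⟨hV _, hfin t h0 h1 α hα.2 _ hx⟩,
      contractibleSpace_of_lincomb_mem (W := CechmFin _ _ _) ⟨hC _, hx⟩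
        fun t h0 h1 α hα => ⟨hC _, hfin t h0 h1 α hα.2 _ hx⟩⟩

end Paper
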